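/- arXiv:1803.06713 — 2 statements merged into one kernel-verified Lean document; each statement's English description precedes it below -/
import Mathlib

section
/- For all r, s ≥ 0, all integers u₁,…,u_r and v₁,…,v_s, and all integers a, b, one has det T(u₁,…,u_r, a, 0, b, v₁,…,v_s) = −det T(u₁,…,u_r, a+b, v₁,…,v_s). -/
/-- `plumbT l` is the intersection matrix of the linear plumbing of spheres with
Euler numbers given by the list `l`: diagonal entries the entries of `l`,
entries `1` on the sub- and super-diagonal, and `0` elsewhere.  For the empty
list this is the `0×0` matrix, whose determinant is `1`. -/
def plumbT (l : List ℤ) : Matrix (Fin l.length) (Fin l.length) ℤ :=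
  Matrix.of fun i j =>
    if (i : ℕ) = (j : ℕ) then l.get i
    else if (i : ℕ) + 1 = (j : ℕ) ∨ (j : ℕ) + 1 = (i : ℕ) then 1 else 0

theorem det_plumbT_nil : (plumbT []).det = 1 :=
  Matrix.det_fin_zero

theorem det_plumbT_singleton (x : ℤ) : (plumbT [x]).det = x := by
  refine (Matrix.det_fin_one (plumbT [x])).trans ?_
  simp [plumbT]

theorem plumbT_cons_submatrix_succ (x : ℤ) (l : List ℤ) :
    (plumbT (x :: l)).submatrix (Fin.succ : Fin l.length → Fin (l.length + 1)) Fin.succ =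
      plumbT l := by
  ext i j
  simp [plumbT]

/-- The three-term recurrence for determinants of linear plumbings. -/
theorem det_plumbT_cons_cons (x y : ℤ) (l : List ℤ) :
    (plumbT (x :: y :: l)).det = x * (plumbT (y :: l)).det - (plumbT l).det := by
  let A : Matrix (Fin (l.length + 2)) (Fin (l.length + 2)) ℤ := plumbT (x :: y :: l)
  have h00 : A 0 0 = x := by simp [A, plumbT]
  have h01 : A 0 1 = 1 := by simp [A, plumbT]
  have h10 : A 1 0 = 1 := by simp [A, plumbT]
  have hrow (j : Fin l.length) : A 0 j.succ.succ = 0 := by simp [A, plumbT]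
  have hcol (i : Fin l.length) : A i.succ.succ 0 = 0 := by simp [A, plumbT]
  have hA : A.submatrix Fin.succ Fin.succ = plumbT (y :: l) :=
    plumbT_cons_submatrix_succ x (y :: l)
  have hminor : (A.submatrix Fin.succ (Fin.succAbove 1)).det = (plumbT l).det := by
    have hl : (A.submatrix Fin.succ (Fin.succAbove 1)).submatrix Fin.succ Fin.succ =
        plumbT l := by
      rw [← plumbT_cons_submatrix_succ y l, ← hA]
      rfl
    rw [Matrix.det_succ_column_zero, Fin.sum_univ_succ]
    simp [hcol, h10, hl]
  change A.det = _
  rw [Matrix.det_succ_row_zero, Fin.sum_univ_succ, Fin.sum_univ_succ]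
  simp [hrow, h00, h01, hA, hminor, sub_eq_add_neg]

theorem det_plumbT_add_cons (a b : ℤ) (l : List ℤ) :
    (plumbT ((a + b) :: l)).det = a * (plumbT l).det + (plumbT (b :: l)).det := by
  cases l with
  | nil => simp only [det_plumbT_singleton, det_plumbT_nil, mul_one]
  | cons y l =>
    simp only [det_plumbT_cons_cons]
    ring

/-- The move `(…, a, 0, b, …) → (…, a+b, …)` on plumbing lines changes the
determinant of the intersection matrix by exactly a sign. -/
theorem det_plumbT_zero_move (u v : List ℤ) (a b : ℤ) :
    (plumbT (u ++ [a, 0, b] ++ v)).det = -(plumbT (u ++ [a + b] ++ v)).det := by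
  induction u using List.twoStepInduction with
  | nil =>
    simp only [List.nil_append, List.cons_append, det_plumbT_cons_cons, det_plumbT_add_cons]
    ring
  | singleton x =>
    simp only [List.nil_append, List.cons_append, det_plumbT_cons_cons, det_plumbT_add_cons]
    ring
  | cons_cons x y u ih₁ ih₂ =>
    simp only [List.cons_append] at ih₁ ih₂ ⊢
    rw [det_plumbT_cons_cons, det_plumbT_cons_cons, ih₁, ih₂]
    ring
end

section
/- For all n ≥ 2 and all integers e₂, e₃, …, eₙ, one has det T(1, e₂, e₃, …, eₙ) = det T(e₂ − 1, e₃, …, eₙ). -/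
/-- The move `(1, e₂, e₃, …, eₙ) → (e₂ − 1, e₃, …, eₙ)` on plumbing lines
preserves the determinant of the intersection matrix.  Here `rest` plays the
role of `(e₃, …, eₙ)`, so the left-hand list has length `n ≥ 2`. -/
theorem det_plumbT_initial_one (e₂ : ℤ) (rest : List ℤ) :
    (plumbT (1 :: e₂ :: rest)).det = (plumbT ((e₂ - 1) :: rest)).det := by
  let A : Matrix (Fin (rest.length + 2)) (Fin (rest.length + 2)) ℤ := plumbT (1 :: e₂ :: rest)
  let B : Matrix (Fin (rest.length + 1)) (Fin (rest.length + 1)) ℤ := plumbT ((e₂ - 1) :: rest)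
  change A.det = B.det
  rw [← Matrix.det_updateRow_add_smul_self A (i := 1) (j := 0) (by simp) (-1),
    Matrix.det_succ_column_zero, Fin.sum_univ_succ, Finset.sum_eq_zero]
  · have hB : (A.updateRow 1 (A 1 + (-1 : ℤ) • A 0)).submatrix (Fin.succAbove 0) Fin.succ = B := by
      ext i j
      refine Fin.cases ?_ (fun i => ?_) i <;> refine Fin.cases ?_ (fun j => ?_) j
      · simp [A, B, plumbT, Matrix.updateRow_apply, sub_eq_add_neg]
      · simp [A, B, plumbT, Matrix.updateRow_apply]
      · simp [A, B, plumbT, Matrix.updateRow_apply, Fin.ext_iff]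
      · simp [A, B, plumbT, Matrix.updateRow_apply, Fin.ext_iff]
    rw [hB]
    simp [A, plumbT, Matrix.updateRow_apply]
  · intro i _
    refine Fin.cases ?_ (fun i => ?_) i
    · simp [A, plumbT, Matrix.updateRow_apply]
    · simp [A, plumbT, Matrix.updateRow_apply, Fin.ext_iff]
end
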